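/- For every positive integer k there exists a constant c = c(k) such that for every integer r ≥ c and all sufficiently large n, the maximum of Σ_v C(d(v), k) over all K_{r+1}-free graphs on n vertices equals the corresponding sum for the Turán graph: ex_φ(n, K_{r+1}) = e_φ(T_r(n)). (Theorem 2, headline form.) -/

import Mathlib

open Finset
open scoped Classical

/-- `e_φ(G) = Σ_v C(deg_G(v), k)`, the sum of `k`-th binomial coefficients of the degrees. -/
noncomputable def ePhi {V : Type*} [Fintype V] (G : SimpleGraph V) (k : ℕ) : ℕ :=
  ∑ v, (G.degree v).choose k

/-- Number of pairs consisting of a vertex in a class of size `a` of a complete multipartite graph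
on `n` vertices and a `k`-set of neighbours of this vertex. -/
def partWeight (n k a : ℕ) : ℤ := a * (n - a).choose k

lemma partWeight_diff {n k j : ℕ} (hj : j < n) :
    ((k + 1 : ℕ) : ℤ) * (partWeight n (k + 1) (j + 1) - partWeight n (k + 1) j) =
      (n - j - 1).choose k * ((n : ℤ) - (k + 1) - (k + 2) * j) := by
  obtain ⟨m, rfl⟩ : ∃ m, n = j + 1 + m := ⟨n - (j + 1), by omega⟩
  have h1 : j + 1 + m - (j + 1) = m := by omega
  have h2 : j + 1 + m - j = m + 1 := by omega
  have h3 : m + 1 - 1 = m := by omega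
  have key : (m.choose (k + 1) : ℤ) * (k + 1) = m.choose k * ((m : ℤ) - k) := by
    rcases le_or_gt k m with h | h
    · have := Nat.choose_succ_right_eq m k
      zify [h] at this
      exact this
    · simp [Nat.choose_eq_zero_of_lt h, Nat.choose_eq_zero_of_lt (h.trans (Nat.lt_succ_self k))]
  simp only [partWeight, h1, h2, h3, Nat.choose_succ_succ m k]
  push_cast
  linear_combination key

lemma partWeight_diff_anti {n k i j : ℕ} (hij : i ≤ j) (hj : j < n)
    (hi : (k + 2) * i + (k + 1) ≤ n) :
    partWeight n (k + 1) (j + 1) - partWeight n (k + 1) j ≤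
      partWeight n (k + 1) (i + 1) - partWeight n (k + 1) i := by
  have hk : (0 : ℤ) < ((k + 1 : ℕ) : ℤ) := by positivity
  refine le_of_mul_le_mul_left ?_ hk
  rw [partWeight_diff hj, partWeight_diff (hij.trans_lt hj)]
  have hc : ((n - j - 1).choose k : ℤ) ≤ (n - i - 1).choose k := by
    exact_mod_cast Nat.choose_le_choose k (by omega)
  have hi' : (0 : ℤ) ≤ (n : ℤ) - (k + 1) - (k + 2) * i := by
    have : (((k + 2) * i + (k + 1) : ℕ) : ℤ) ≤ n := by exact_mod_cast hi
    push_cast at this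
    linarith
  have hl : (n : ℤ) - (k + 1) - (k + 2) * j ≤ (n : ℤ) - (k + 1) - (k + 2) * i := by
    have : (i : ℤ) ≤ j := by exact_mod_cast hij
    gcongr
  calc _ ≤ ((n - j - 1).choose k : ℤ) * ((n : ℤ) - (k + 1) - (k + 2) * i) := by gcongr
    _ ≤ _ := by gcongr

/-- The chord of `partWeight` through `q` and `q + 1` lies above `partWeight`. -/
lemma partWeight_le_chord {n k q a : ℕ} (hqn : q < n) (hq : (k + 2) * q + (k + 1) ≤ n)
    (ha : a ≤ n) :
    partWeight n (k + 1) a ≤ partWeight n (k + 1) q +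
      (partWeight n (k + 1) (q + 1) - partWeight n (k + 1) q) * ((a : ℤ) - q) := by
  rcases le_total q a with h | h
  · induction a, h using Nat.le_induction with
    | base => simp
    | succ a h ih =>
      have h1 := ih (by omega)
      have h2 := partWeight_diff_anti (k := k) h (show a < n by omega) hq
      push_cast
      linarith
  · induction h using Nat.decreasingInduction with
    | self => simp
    | of_succ a h ih =>
      have h1 := ih (by omega)
      have h2 := partWeight_diff_anti (k := k) (n := n) h.le hqn
        ((Nat.add_le_add_right (Nat.mul_le_mul_left _ h.le) _).trans hq)
      push_cast at h1
      linarith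

/-- Erdős' degree majorization: the degrees of a `K_{r+1}`-free graph are dominated by those of
a complete `r`-partite graph. -/
lemma exists_coloring_degree_le {V : Type*} [Fintype V] (G : SimpleGraph V) (r : ℕ) :
    ∀ S : Finset V, G.CliqueFreeOn S (r + 1) → ∃ c : V → ℕ, (∀ v ∈ S, c v < r) ∧
      ∀ v ∈ S, #{w ∈ S | G.Adj v w} ≤ #{w ∈ S | c w ≠ c v} := by
  induction r with
  | zero =>
    intro S hS
    have hS' : ∀ v, v ∉ S := fun v hv =>
      hS (t := {v}) (by simpa using hv) (by simp [SimpleGraph.isNClique_iff])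
    exact ⟨fun _ => 0, fun v hv => (hS' v hv).elim, fun v hv => (hS' v hv).elim⟩
  | succ r ih =>
    intro S hS
    rcases S.eq_empty_or_nonempty with rfl | hne
    · exact ⟨fun _ => 0, by simp, by simp⟩
    obtain ⟨v, hv, hmax⟩ := S.exists_max_image (fun v => #{w ∈ S | G.Adj v w}) hne
    set N : Finset V := {w ∈ S | G.Adj v w} with hN
    have hNS : N ⊆ S := filter_subset _ _
    have hNfree : G.CliqueFreeOn N (r + 1) := by
      intro t ht hcl
      refine hS (t := insert v t) ?_ (hcl.insert fun b hb => ?_)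
      · intro x hx
        rcases mem_insert.1 (mem_coe.1 hx) with rfl | hx
        · exact hv
        · exact hNS (ht hx)
      · exact (mem_filter.1 (ht hb)).2
    obtain ⟨c, hc, hdeg⟩ := ih N hNfree
    refine ⟨fun w => if w ∈ N then c w else r, fun w _ => ?_, fun w hw => ?_⟩
    · by_cases h : w ∈ N
      · simpa [h] using (hc w h).trans (Nat.lt_succ_self r)
      · simp [h]
    · by_cases h : w ∈ N
      · calc #{x ∈ S | G.Adj w x} ≤ #({x ∈ N | G.Adj w x} ∪ (S \ N)) := by
              refine card_le_card fun x hx => ?_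
              simp only [mem_filter, mem_union, mem_sdiff] at hx ⊢
              tauto
          _ ≤ #{x ∈ N | G.Adj w x} + #(S \ N) := card_union_le _ _
          _ ≤ #{x ∈ N | c x ≠ c w} + #(S \ N) := Nat.add_le_add_right (hdeg w h) _
          _ = #({x ∈ N | c x ≠ c w} ∪ (S \ N)) := by
              refine (card_union_of_disjoint ?_).symm
              exact disjoint_sdiff.mono_left (filter_subset _ _)
          _ ≤ _ := by
              refine card_le_card fun x hx => ?_
              rcases mem_union.1 hx with hx | hx
              · obtain ⟨hxN, hx⟩ := mem_filter.1 hx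
                simpa [h, hxN, hNS hxN] using hx
              · obtain ⟨hxS, hxN⟩ := mem_sdiff.1 hx
                simpa [h, hxN, hxS] using (hc w h).ne'
      · refine (hmax w hw).trans (card_le_card fun x hx => ?_)
        simpa [h, hx, hNS hx] using (hc x hx).ne

lemma sum_choose_eq_sum_partWeight {n r : ℕ} (k : ℕ) (c : Fin n → ℕ) (hc : ∀ v, c v < r) :
    ((∑ v, (#{w | c w ≠ c v}).choose k : ℕ) : ℤ) =
      ∑ i ∈ range r, partWeight n k #{w | c w = i} := by
  have hcard : ∀ i, #{w | c w ≠ i} = n - #{w | c w = i} := by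
    intro i
    have := card_filter_add_card_filter_not (s := (univ : Finset (Fin n))) (fun w => c w = i)
    simp only [card_univ, Fintype.card_fin] at this
    simp only [ne_eq]
    omega
  rw [← sum_fiberwise_of_maps_to (s := univ) (t := range r) (g := c) (by simpa using hc)]
  push_cast
  refine sum_congr rfl fun i _ => ?_
  rw [sum_congr rfl (g := fun _ => ((n - #{w | c w = i}).choose k : ℤ))]
  · simp [partWeight]
  · intro v hv
    rw [(mem_filter.1 hv).2, hcard]

lemma sum_card_color {n r : ℕ} (c : Fin n → ℕ) (hc : ∀ v, c v < r) :
    ∑ i ∈ range r, (#{w | c w = i} : ℤ) = n := by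
  have := card_eq_sum_card_fiberwise (s := univ) (t := range r) (f := c)
    (by intro v _; simpa using hc v)
  rw [card_univ, Fintype.card_fin] at this
  exact_mod_cast this.symm

lemma card_fin_mod_eq {n r i : ℕ} (hi : i < r) :
    #{w : Fin n | (w : ℕ) % r = i} = n / r ∨ #{w : Fin n | (w : ℕ) % r = i} = n / r + 1 := by
  have h : #{w : Fin n | (w : ℕ) % r = i} = n.count (· ≡ i [MOD r]) := by
    rw [Nat.count_eq_card_filter_range, ← card_map Fin.valEmbedding]
    congr 1
    ext x
    simp only [mem_map, mem_filter, mem_univ, true_and, mem_range, Fin.valEmbedding_apply,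
      Nat.ModEq, Nat.mod_eq_of_lt hi]
    exact ⟨fun ⟨w, hw, h⟩ => h ▸ ⟨w.2, hw⟩, fun ⟨hx, h⟩ => ⟨⟨x, hx⟩, h, rfl⟩⟩
  rw [h, Nat.count_modEq_card n (by omega)]
  split_ifs <;> simp

lemma ePhi_turanGraph (n r k : ℕ) :
    ePhi (SimpleGraph.turanGraph n r) k =
      ∑ v : Fin n, (#{w : Fin n | (w : ℕ) % r ≠ v % r}).choose k := by
  unfold ePhi
  refine sum_congr rfl fun v _ => ?_
  rw [← SimpleGraph.card_neighborFinset_eq_degree]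
  congr 2
  ext w
  simp [SimpleGraph.turanGraph_adj, eq_comm]

/-- For every `k ≥ 1` there exists a constant `c = c(k)` such that for every integer
`r ≥ c` and all sufficiently large `n`, the maximum of `Σ_v C(deg v, k)` over all
`K_{r+1}`-free graphs on `n` vertices equals the corresponding sum for `T_r(n)`. -/
theorem ex_phi_eq_turan_large_r (k : ℕ) (hk : 1 ≤ k) :
    ∃ c : ℝ, ∀ r : ℕ, c ≤ (r : ℝ) → ∃ N : ℕ, ∀ n : ℕ, N ≤ n →
      IsGreatest {m : ℕ | ∃ G : SimpleGraph (Fin n), G.CliqueFree (r + 1) ∧ ePhi G k = m}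
        (ePhi (SimpleGraph.turanGraph n r) k) := by
  obtain ⟨k, rfl⟩ : ∃ l, k = l + 1 := ⟨k - 1, by omega⟩
  refine ⟨((k + 3 : ℕ) : ℝ), fun r hr => ⟨(k + 1) * (k + 3), fun n hn => ?_⟩⟩
  have hr : k + 3 ≤ r := by exact_mod_cast hr
  refine ⟨⟨_, SimpleGraph.turanGraph_cliqueFree (by omega), rfl⟩, ?_⟩
  rintro _ ⟨G, hG, rfl⟩
  have hqr : (k + 3) * (n / r) ≤ n :=
    (Nat.mul_le_mul_right _ hr).trans (Nat.mul_div_le n r)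
  have hn0 : 0 < n := lt_of_lt_of_le (by positivity) hn
  have hqn : n / r < n := Nat.div_lt_self hn0 (by omega)
  have hq : (k + 2) * (n / r) + (k + 1) ≤ n := by
    rcases le_or_gt (k + 1) (n / r) with h | h
    · linarith
    · nlinarith
  obtain ⟨c, hc, hdeg⟩ := exists_coloring_degree_le G r univ
    (fun t _ => hG t)
  have hc' : ∀ v, c v < r := fun v => hc v (mem_univ v)
  have hmod : ∀ v : Fin n, (v : ℕ) % r < r := fun v => Nat.mod_lt _ (by omega)
  set q := n / r
  set D := partWeight n (k + 1) (q + 1) - partWeight n (k + 1) q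
  have hchord : ∀ c : Fin n → ℕ, (∀ v, c v < r) →
      ∑ i ∈ range r, (partWeight n (k + 1) q + D * ((#{w | c w = i} : ℤ) - q)) =
        r * partWeight n (k + 1) q + D * (n - r * q) := by
    intro c hc
    rw [sum_add_distrib, ← mul_sum, sum_sub_distrib, sum_card_color c hc]
    simp
  have hle : ePhi G (k + 1) ≤ ∑ v, (#{w | c w ≠ c v}).choose (k + 1) := by
    refine sum_le_sum fun v _ => Nat.choose_le_choose _ ?_
    rw [← SimpleGraph.card_neighborFinset_eq_degree, SimpleGraph.neighborFinset_eq_filter]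
    exact hdeg v (mem_univ v)
  refine hle.trans ?_
  rw [ePhi_turanGraph]
  rw [← Int.ofNat_le, sum_choose_eq_sum_partWeight (k + 1) c hc',
    sum_choose_eq_sum_partWeight (k + 1) (fun v : Fin n => (v : ℕ) % r) hmod]
  calc _ ≤ ∑ i ∈ range r, (partWeight n (k + 1) q + D * ((#{w | c w = i} : ℤ) - q)) :=
        sum_le_sum fun i _ => partWeight_le_chord hqn hq
          ((card_le_univ _).trans_eq (Fintype.card_fin n))
    _ = ∑ i ∈ range r,
          (partWeight n (k + 1) q + D * ((#{w : Fin n | (w : ℕ) % r = i} : ℤ) - q)) := by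
        rw [hchord c hc', hchord _ hmod]
    _ = _ := by
        refine sum_congr rfl fun i hi => ?_
        rcases card_fin_mod_eq (n := n) (mem_range.1 hi) with h | h
        · rw [h]; simp [q]
        · rw [h]; simp [q, D]
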